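/- arXiv:1501.07491 — 4 statements merged into one kernel-verified Lean document; each statement's English description precedes it below -/
import Mathlib

section
/- Let α, β, γ ∈ ℝ with γ ≠ 0 and α² + βγ > 0, set τ := √(α² + βγ), and let x ∈ ℝ and t ∈ ℝ be such that cosh(τs) + ((α − γx)/τ)·sinh(τs) > 0 for all s between 0 and t. Then ∫₀ᵗ [ (cosh(τs) − (α/τ)sinh(τs))·x − (β/τ)sinh(τs) ] / [ cosh(τs) + ((α − γx)/τ)·sinh(τs) ] ds = (1/γ)·( α·t − log( cosh(τt) + ((α − γx)/τ)·sinh(τt) ) ). (The integrand is M(s).x where M(s) = exp(s(−αH + γE + βF)) acts by the stereographic action g.x = (ax−c)/(−bx+d).) -/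
/-- The integral of the Möbius flow `M(s).x` for `M(s) = exp(s(−αH+γE+βF))`:
`∫₀ᵗ M(s).x ds = (1/γ)(αt − log(cosh(τt) + ((α−γx)/τ) sinh(τt)))`. -/
theorem integral_mobius_flow (α β γ : ℝ) (hγ : γ ≠ 0) (h : 0 < α ^ 2 + β * γ)
    (τ : ℝ) (hτ : τ = Real.sqrt (α ^ 2 + β * γ)) (x t : ℝ)
    (hpos : ∀ s ∈ Set.uIcc (0 : ℝ) t,
      0 < Real.cosh (τ * s) + (α - γ * x) / τ * Real.sinh (τ * s)) :
    ∫ s in (0 : ℝ)..t,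
        ((Real.cosh (τ * s) - α / τ * Real.sinh (τ * s)) * x - β / τ * Real.sinh (τ * s)) /
          (Real.cosh (τ * s) + (α - γ * x) / τ * Real.sinh (τ * s)) =
      1 / γ * (α * t - Real.log (Real.cosh (τ * t) + (α - γ * x) / τ * Real.sinh (τ * t))) := by
  have hτ_ne : τ ≠ 0 := by
    rw [hτ]
    exact (Real.sqrt_pos.mpr h).ne'
  have hτ_sq : τ ^ 2 = α ^ 2 + β * γ := by
    rw [hτ]
    exact Real.sq_sqrt h.le
  have hlin (s : ℝ) : HasDerivAt (fun s => τ * s) τ s := by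
    simpa using (hasDerivAt_id s).const_mul τ
  have hderiv : ∀ s ∈ Set.uIcc (0 : ℝ) t,
      HasDerivAt
        (fun s => 1 / γ * (α * s -
          Real.log (Real.cosh (τ * s) + (α - γ * x) / τ * Real.sinh (τ * s))))
        (((Real.cosh (τ * s) - α / τ * Real.sinh (τ * s)) * x - β / τ * Real.sinh (τ * s)) /
          (Real.cosh (τ * s) + (α - γ * x) / τ * Real.sinh (τ * s))) s := by
    intro s hs
    have hne := (hpos s hs).ne'
    have hden := (hlin s).cosh.add ((hlin s).sinh.const_mul ((α - γ * x) / τ))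
    refine ((((hasDerivAt_id s).const_mul α).sub (hden.log hne)).const_mul (1 / γ)).congr_deriv ?_
    simp only [Pi.add_apply]
    rw [eq_div_iff hne, mul_assoc, sub_mul, div_mul_cancel₀ _ hne]
    field_simp
    linear_combination (-Real.sinh (τ * s)) * hτ_sq
  have hcont : ContinuousOn
      (fun s => ((Real.cosh (τ * s) - α / τ * Real.sinh (τ * s)) * x -
        β / τ * Real.sinh (τ * s)) /
          (Real.cosh (τ * s) + (α - γ * x) / τ * Real.sinh (τ * s))) (Set.uIcc 0 t) :=
    ContinuousOn.div (by fun_prop) (by fun_prop) fun s hs => (hpos s hs).ne'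
  rw [intervalIntegral.integral_eq_sub_of_hasDerivAt hderiv hcont.intervalIntegrable]
  simp
end

section
/- Let κ > 0, θ > 0, ε ∈ {+1, −1}, and (a, ℓ) ∈ ℝ². For a continuous compactly supported ψ : ℝ → ℂ define (J_ε ψ)(q) := √(κ/(2πθ)) ∫_ℝ exp( −(iκε/(2θ))·e^{−2a₀}·q ) · e^{−a₀} · ψ(a₀) da₀, and (U¹_ε(a,ℓ)ψ)(a₀) := exp( (iκε/(2θ))·e^{2(a−a₀)}·ℓ ) · ψ(a₀ − a). Then for every q₀ ∈ ℝ: J_ε( U¹_ε(a,ℓ) ψ )(q₀) = e^{−a} · (J_ε ψ)( e^{−2a}·q₀ − ℓ ). (The operator J_ε intertwines the induced representation U¹_ε of the Iwasawa group with the representation U(a,ℓ)φ(q₀) = e^{−a} φ(e^{−2a}q₀ − ℓ).) -/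
open MeasureTheory Complex Real

/-- The operator `J_ε ψ(q) = √(κ/(2πθ)) ∫ exp(−(iκε/(2θ)) e^{−2a₀} q) e^{−a₀} ψ(a₀) da₀`. -/
noncomputable def Jop (κ θ ε : ℝ) (ψ : ℝ → ℂ) : ℝ → ℂ := fun q =>
  (Real.sqrt (κ / (2 * π * θ)) : ℂ) *
    ∫ a₀ : ℝ, Complex.exp (-(I * (κ * ε / (2 * θ)) * Real.exp (-2 * a₀) * q)) *
      Real.exp (-a₀) * ψ a₀

/-- The induced representation of the Iwasawa group:
`(U¹_ε(a,ℓ)ψ)(a₀) = exp((iκε/(2θ)) e^{2(a−a₀)} ℓ) · ψ(a₀ − a)`. -/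
noncomputable def iwasawaRep (κ θ ε : ℝ) (a ℓ : ℝ) (ψ : ℝ → ℂ) : ℝ → ℂ := fun a₀ =>
  Complex.exp (I * (κ * ε / (2 * θ)) * Real.exp (2 * (a - a₀)) * ℓ) * ψ (a₀ - a)

/-- `J_ε` intertwines the induced representation `U¹_ε` of the Iwasawa group with the
representation `U(a,ℓ)φ(q₀) = e^{−a} φ(e^{−2a}q₀ − ℓ)`. -/
theorem Jop_intertwines (κ θ ε : ℝ) (hκ : 0 < κ) (hθ : 0 < θ) (hε : ε = 1 ∨ ε = -1)
    (a ℓ : ℝ) (ψ : ℝ → ℂ) (hψc : Continuous ψ) (hψs : HasCompactSupport ψ) :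
    ∀ q₀ : ℝ, Jop κ θ ε (iwasawaRep κ θ ε a ℓ ψ) q₀ =
      Real.exp (-a) * Jop κ θ ε ψ (Real.exp (-2 * a) * q₀ - ℓ) := by
  intro q₀
  simp only [Jop, iwasawaRep]
  rw [mul_left_comm]
  congr 1
  rw [← integral_const_mul, ← integral_add_right_eq_self _ a]
  congr 1 with b
  have h₁ : Real.exp (-2 * (b + a)) = Real.exp (-2 * b) * Real.exp (-2 * a) := by
    rw [← Real.exp_add]; ring_nf
  have h₂ : Real.exp (-(b + a)) = Real.exp (-a) * Real.exp (-b) := by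
    rw [← Real.exp_add]; ring_nf
  have h₃ : Real.exp (2 * (a - (b + a))) = Real.exp (-2 * b) := by ring_nf
  rw [h₁, h₂, h₃, add_sub_cancel_right]
  have h₄ : ∀ c x y q l : ℂ, Complex.exp (-(c * x * (y * q - l))) =
      Complex.exp (-(c * (x * y) * q)) * Complex.exp (c * x * l) := by
    intro c x y q l
    rw [← Complex.exp_add]; ring_nf
  push_cast [-Complex.ofReal_exp]
  rw [h₄]
  ring
end

section
/- Let κ > 0, θ ≠ 0, α, β, γ ∈ ℝ with α² + βγ > 0, and set τ := √(α² + βγ). Let f : ℝ → ℂ be continuously differentiable. Define D(t,x) := cosh(τt) + ((α − γx)/τ)·sinh(τt), g(t,x) := ( (cosh(τt) − (α/τ)sinh(τt))·x − (β/τ)sinh(τt) ) / D(t,x), and v(t,x) := |D(t,x)|^(−1 + i√κ/θ) · f(g(t,x)) on the open set Ω := {(t,x) ∈ ℝ² : D(t,x) ≠ 0}. Then on Ω the function v satisfies the first-order PDE ∂_t v(t,x) = (i/θ)·(√κ + iθ)·(α − γx)·v(t,x) + (γx² − 2αx − β)·∂_x v(t,x), with v(0,x) = f(x). (This is the resolution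 of the defining equation of the star-exponential in the chart Ψ_κ, expressing it through the principal series.) -/
open Complex

/-- A complex power of the absolute value of a nonvanishing real function, differentiated. -/
lemma hasDerivAt_abs_cpow {u : ℝ → ℝ} {u' t : ℝ} (c : ℂ) (hu : HasDerivAt u u' t)
    (h0 : u t ≠ 0) :
    HasDerivAt (fun s => ((|u s| : ℝ) : ℂ) ^ c)
      (((|u t| : ℝ) : ℂ) ^ c * ((u' / u t : ℝ) * c)) t := by
  have hexp : ∀ s, u s ≠ 0 →
      ((|u s| : ℝ) : ℂ) ^ c = Complex.exp ((Real.log (u s) : ℝ) * c) := by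
    intro s hs
    rw [Complex.cpow_def_of_ne_zero (by simpa using hs), ← Complex.ofReal_log (abs_nonneg _),
      Real.log_abs]
  rw [hexp t h0]
  refine (((hu.log h0).ofReal_comp.mul_const c).cexp).congr_of_eventuallyEq ?_
  filter_upwards [hu.continuousAt.eventually_ne h0] with s hs using hexp s hs

/-- The derivative of `|u|^c · f(n / u)` for real functions `u`, `n` with `u ≠ 0`. -/
lemma hasDerivAt_abs_cpow_mul_comp_div {u n : ℝ → ℝ} {u' n' t : ℝ} (c : ℂ) {f : ℝ → ℂ}
    (hf : Differentiable ℝ f) (hu : HasDerivAt u u' t) (hn : HasDerivAt n n' t)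
    (h0 : u t ≠ 0) :
    HasDerivAt (fun s => ((|u s| : ℝ) : ℂ) ^ c * f (n s / u s))
      (((|u t| : ℝ) : ℂ) ^ c * ((u' / u t : ℝ) * c) * f (n t / u t) +
        ((|u t| : ℝ) : ℂ) ^ c *
          (((n' * u t - n t * u') / u t ^ 2 : ℝ) * deriv f (n t / u t))) t := by
  have hcomp := (hf (n t / u t)).hasDerivAt.scomp t (hn.div hu h0)
  rw [Complex.real_smul] at hcomp
  exact (hasDerivAt_abs_cpow c hu h0).mul hcomp

/-- Resolution of the defining equation of the star-exponential in the chart `Ψ_κ`: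
the function `v(t,x) = |D(t,x)|^(−1+i√κ/θ) f(g(t,x))`, built from the hyperbolic flow,
satisfies the first-order PDE
`∂ₜv = (i/θ)(√κ+iθ)(α−γx) v + (γx²−2αx−β) ∂ₓv` with `v(0,x) = f(x)`. -/
theorem star_exponential_PDE (κ θ α β γ : ℝ) (hκ : 0 < κ) (hθ : θ ≠ 0)
    (hτpos : 0 < α ^ 2 + β * γ) (τ : ℝ) (hτ : τ = Real.sqrt (α ^ 2 + β * γ))
    (f : ℝ → ℂ) (hf : ContDiff ℝ 1 f)
    (D : ℝ → ℝ → ℝ)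
    (hD : ∀ t x, D t x = Real.cosh (τ * t) + (α - γ * x) / τ * Real.sinh (τ * t))
    (g : ℝ → ℝ → ℝ)
    (hg : ∀ t x, g t x =
      ((Real.cosh (τ * t) - α / τ * Real.sinh (τ * t)) * x - β / τ * Real.sinh (τ * t)) /
        D t x)
    (v : ℝ → ℝ → ℂ)
    (hv : ∀ t x, v t x =
      ((|D t x| : ℝ) : ℂ) ^ ((-1 : ℂ) + (Real.sqrt κ / θ : ℝ) * I) * f (g t x)) :
    (∀ x : ℝ, v 0 x = f x) ∧
      ∀ t x : ℝ, D t x ≠ 0 →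
        HasDerivAt (fun s => v s x)
          (I / (θ : ℂ) * ((Real.sqrt κ : ℂ) + I * θ) * ((α : ℂ) - γ * x) * v t x +
            ((γ * x ^ 2 - 2 * α * x - β : ℝ) : ℂ) * deriv (fun ξ => v t ξ) x) t := by
  have hτ0 : τ ≠ 0 := by
    rw [hτ]
    exact (Real.sqrt_pos.mpr hτpos).ne'
  have hτ2 : τ ^ 2 = α ^ 2 + β * γ := by
    rw [hτ, Real.sq_sqrt hτpos.le]
  refine ⟨fun x => by simp [hv, hg, hD], fun t x h0 => ?_⟩
  have hC : HasDerivAt (fun s => Real.cosh (τ * s)) (Real.sinh (τ * t) * τ) t := by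
    simpa using ((hasDerivAt_id t).const_mul τ).cosh
  have hS : HasDerivAt (fun s => Real.sinh (τ * s)) (Real.cosh (τ * t) * τ) t := by
    simpa using ((hasDerivAt_id t).const_mul τ).sinh
  set C := Real.cosh (τ * t)
  set S := Real.sinh (τ * t)
  let N : ℝ → ℝ → ℝ := fun s y =>
    (Real.cosh (τ * s) - α / τ * Real.sinh (τ * s)) * y - β / τ * Real.sinh (τ * s)
  have hDt : HasDerivAt (fun s => D s x) (S * τ + (α - γ * x) / τ * (C * τ)) t := by
    simp only [hD]
    exact hC.add (hS.const_mul _)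
  have hNt : HasDerivAt (fun s => N s x)
      ((S * τ - α / τ * (C * τ)) * x - β / τ * (C * τ)) t :=
    ((hC.sub (hS.const_mul _)).mul_const x).sub (hS.const_mul _)
  have hDx : HasDerivAt (fun y => D t y) (-γ / τ * S) x := by
    simp only [hD]
    have h := (((((hasDerivAt_id x).const_mul γ).const_sub α).div_const τ).mul_const S).const_add C
    simpa using h
  have hNx : HasDerivAt (fun y => N t y) (C - α / τ * S) x := by
    have h := ((hasDerivAt_id x).const_mul (C - α / τ * S)).sub_const (β / τ * S)
    rwa [mul_one] at h
  have hfd : Differentiable ℝ f := hf.differentiable (by norm_num)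
  set c : ℂ := (-1 : ℂ) + (Real.sqrt κ / θ : ℝ) * I with hc
  have hvN : ∀ s y, v s y = ((|D s y| : ℝ) : ℂ) ^ c * f (N s y / D s y) := by
    intro s y
    rw [hv, hg]
  have hvt := hasDerivAt_abs_cpow_mul_comp_div c hfd hDt hNt h0
  have hvx := hasDerivAt_abs_cpow_mul_comp_div c hfd hDx hNx h0
  have hcoef : I / (θ : ℂ) * ((Real.sqrt κ : ℂ) + I * θ) = c := by
    have hθ' : (θ : ℂ) ≠ 0 := by exact_mod_cast hθ
    rw [hc]
    push_cast
    field_simp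
    linear_combination (θ : ℂ) * I_sq
  have hDval : D t x = C + (α - γ * x) / τ * S := hD t x
  have hNval : N t x = (C - α / τ * S) * x - β / τ * S := rfl
  have hDeq : S * τ + (α - γ * x) / τ * (C * τ) =
      (α - γ * x) * D t x + (γ * x ^ 2 - 2 * α * x - β) * (-γ / τ * S) := by
    rw [hDval]
    field_simp
    linear_combination S * hτ2
  have hNeq : (S * τ - α / τ * (C * τ)) * x - β / τ * (C * τ) =
      (α - γ * x) * N t x + (γ * x ^ 2 - 2 * α * x - β) * (C - α / τ * S) := by
    rw [hNval]
    field_simp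
    linear_combination S * x * hτ2
  have hlog : (S * τ + (α - γ * x) / τ * (C * τ)) / D t x =
      (α - γ * x) + (γ * x ^ 2 - 2 * α * x - β) * (-γ / τ * S / D t x) := by
    rw [hDeq, add_div, mul_div_cancel_right₀ _ h0, mul_div_assoc]
  have hquot : (((S * τ - α / τ * (C * τ)) * x - β / τ * (C * τ)) * D t x -
        N t x * (S * τ + (α - γ * x) / τ * (C * τ))) / D t x ^ 2 =
      (γ * x ^ 2 - 2 * α * x - β) *
        (((C - α / τ * S) * D t x - N t x * (-γ / τ * S)) / D t x ^ 2) := by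
    rw [hDeq, hNeq]
    ring
  rw [hlog, hquot] at hvt
  simp only [hvN]
  rw [hvx.deriv, hcoef]
  convert hvt using 1
  simp only [ofReal_mul, ofReal_add, ofReal_sub (α)]
  ring
end

section
/- Let κ > 0, θ > 0, β ∈ ℝ, ε ∈ {+1, −1}, and let f : ℝ² → ℂ be a Schwartz function. Define (W_ε f)(a₀, ℓ₀) := (κ/(2πθ)) · e^{−2a₀} ∫_ℝ ∫_ℝ (1+η²)^(−1/4) · (√(1+η²)+η)^(i β √κ/θ) · exp( (iκε/θ)·η·(ℓ₀ − e^{−2a₀}·q) ) · f( q, (√κ ε/2)·e^{−2a₀}·√(1+η²) ) dη dq, and for (a, ℓ) ∈ ℝ² let τ_{(a,ℓ)}(x, y) := ((x + ℓ)·e^{2a}, y·e^{−2a}). Then for all (a, ℓ), (a₀, ℓ₀) ∈ ℝ²: W_ε( f ∘ τ_{(a,ℓ)} )(a₀, ℓ₀) = (W_ε f)( a + a₀, ℓ₀ + ℓ·e^{−2a₀} ). (S-equivariance of the intertwiner W_ε: it intertwines the affine action of the Iwasawa group S on the chart Ψ_κ with left translations on S, whose group law is (a,ℓ)·(a₀,ℓ₀)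 = (a+a₀, ℓ₀+ℓe^{−2a₀}).) -/
open MeasureTheory Complex Real

/-- The intertwining operator
`(W_ε f)(a₀,ℓ₀) = (κ/(2πθ)) e^{−2a₀} ∬ (1+η²)^(−1/4) (√(1+η²)+η)^(iβ√κ/θ)
  exp((iκε/θ)η(ℓ₀ − e^{−2a₀}q)) f(q, (√κ ε/2) e^{−2a₀} √(1+η²)) dη dq`. -/
noncomputable def Wop (κ θ β ε : ℝ) (f : ℝ × ℝ → ℂ) : ℝ × ℝ → ℂ := fun p =>
  ((κ / (2 * π * θ) : ℝ) : ℂ) * (Real.exp (-2 * p.1) : ℂ) *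
    ∫ q : ℝ, ∫ η : ℝ,
      (((1 + η ^ 2) ^ (-(1 / 4) : ℝ) : ℝ) : ℂ) *
        ((Real.sqrt (1 + η ^ 2) + η : ℝ) : ℂ) ^ ((β * Real.sqrt κ / θ : ℝ) * I) *
        Complex.exp (I * (κ * ε / θ) * η * (p.2 - Real.exp (-2 * p.1) * q)) *
        f (q, Real.sqrt κ * ε / 2 * Real.exp (-2 * p.1) * Real.sqrt (1 + η ^ 2))

/-- The affine action `τ_{(a,ℓ)}(x,y) = ((x+ℓ)e^{2a}, y e^{−2a})` of the Iwasawa group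
on the chart `Ψ_κ`. -/
noncomputable def tauAct (a ℓ : ℝ) : ℝ × ℝ → ℝ × ℝ := fun p =>
  ((p.1 + ℓ) * Real.exp (2 * a), p.2 * Real.exp (-2 * a))

/-- `S`-equivariance of the intertwiner `W_ε`: it intertwines the affine action of the
Iwasawa group `S` on the chart `Ψ_κ` with the left translations on `S`, whose group law
is `(a,ℓ)·(a₀,ℓ₀) = (a+a₀, ℓ₀+ℓe^{−2a₀})`. -/
theorem Wop_equivariant (κ θ β ε : ℝ) (hκ : 0 < κ) (hθ : 0 < θ)
    (hε : ε = 1 ∨ ε = -1) (f : SchwartzMap (ℝ × ℝ) ℂ) :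
    ∀ a ℓ a₀ ℓ₀ : ℝ,
      Wop κ θ β ε (⇑f ∘ tauAct a ℓ) (a₀, ℓ₀) =
        Wop κ θ β ε (⇑f) (a + a₀, ℓ₀ + ℓ * Real.exp (-2 * a₀)) := by
  intro a ℓ a₀ ℓ₀
  have exp_split : Real.exp (-2 * (a + a₀)) = Real.exp (-2 * a₀) * Real.exp (-2 * a) := by
    rw [← Real.exp_add]; ring_nf
  have exp_cancel : Real.exp (-2 * a) * Real.exp (2 * a) = 1 := by
    rw [← Real.exp_add]; simp
  have exp_cancel_ofReal : (Real.exp (-2 * a) : ℂ) * (Real.exp (2 * a) : ℂ) = 1 := by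
    exact_mod_cast exp_cancel
  simp only [Wop, Function.comp_apply, tauAct, exp_split]
  set G : ℝ → ℂ := fun q => ∫ η : ℝ,
      (((1 + η ^ 2) ^ (-(1 / 4) : ℝ) : ℝ) : ℂ) *
        ((Real.sqrt (1 + η ^ 2) + η : ℝ) : ℂ) ^ ((β * Real.sqrt κ / θ : ℝ) * I) *
        Complex.exp (I * (κ * ε / θ) * η * (((ℓ₀ + ℓ * Real.exp (-2 * a₀) : ℝ) : ℂ) -
          ((Real.exp (-2 * a₀) * Real.exp (-2 * a) : ℝ) : ℂ) * q)) *
        f (q, Real.sqrt κ * ε / 2 * (Real.exp (-2 * a₀) * Real.exp (-2 * a)) *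
          Real.sqrt (1 + η ^ 2)) with hG
  have change_of_variables : ∫ q : ℝ, G ((q + ℓ) * Real.exp (2 * a)) =
      (Real.exp (-2 * a) : ℂ) * ∫ q : ℝ, G q := by
    rw [integral_add_right_eq_self (fun q => G (q * Real.exp (2 * a))) ℓ,
      Measure.integral_comp_mul_right, abs_of_pos (inv_pos.mpr (Real.exp_pos _)),
      ← eq_inv_of_mul_eq_one_left exp_cancel, Complex.real_smul]
  rw [Complex.ofReal_mul (Real.exp (-2 * a₀)), ← mul_assoc, mul_assoc _ (Real.exp (-2 * a) : ℂ),
    ← change_of_variables]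
  congr 2
  funext q
  simp only [hG]
  congr 1
  funext η
  congr 2
  · congr 2
    push_cast [-Complex.ofReal_exp]
    linear_combination ((Real.exp (-2 * a₀) : ℂ) * (q + ℓ)) * exp_cancel_ofReal
  · congr 1
    ring
end
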